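/- arXiv:2211.05106 — 2 statements merged into one kernel-verified Lean document; each statement's English description precedes it below -/
import Mathlib

section
/- Let p be a prime. For every w ∈ ℍ and almost every z ∈ ℍ the following holds: for every real ζ with 0 < ζ < 1 and every ε₀ > 0 there exists ε with 0 < ε < ε₀ such that every matrix γ ∈ SL₂(ℚ) with all entries in ℤ[1/p] and ht(γ) ≤ ζ · log(ε⁻¹)/log p satisfies dist(γ⁻¹ · z, w) > ε. (This is the n = 2 case of the lower bound κ(z, w) ≥ 1 for the Diophantine exponent.) -/
open MeasureTheory UpperHalfPlane
open scoped MatrixGroups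

noncomputable section

/-- `q` lies in `ℤ[1/p]`, i.e. is of the form `a / p ^ m`. -/
def IsZInvP (p : ℕ) (q : ℚ) : Prop := ∃ (a : ℤ) (m : ℕ), q = (a : ℚ) / (p : ℚ) ^ m

/-- A rational matrix has integer entries. -/
def IsIntMat {n : ℕ} (A : Matrix (Fin n) (Fin n) ℚ) : Prop := ∀ i j, ∃ z : ℤ, A i j = (z : ℚ)

/-- The height of a matrix with entries in `ℤ[1/p]`: the least `k` such that `p ^ k • γ`
is an integer matrix. -/
def ht (p : ℕ) {n : ℕ} (γ : Matrix (Fin n) (Fin n) ℚ) : ℕ :=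
  sInf {k : ℕ | IsIntMat ((p : ℚ) ^ k • γ)}


theorem divisor_bound (δ : ℝ) (hδ : 0 < δ) :
    ∃ K : ℝ, 0 < K ∧ ∀ n : ℕ, n ≠ 0 → (n.divisors.card : ℝ) ≤ K * (n : ℝ) ^ δ := by
  obtain ⟨B, hB⟩ := exists_nat_ge ((2 : ℝ) ^ (1 / δ))
  have hl2 : 0 < Real.log 2 := Real.log_pos (by norm_num)
  set L : ℝ := 1 + 1 / (δ * Real.log 2) with hL
  have hL1 : 1 ≤ L := by
    have : 0 < 1 / (δ * Real.log 2) := by positivity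
    linarith
  have key : ∀ q : ℕ, q.Prime → ∀ e : ℕ,
      (e + 1 : ℝ) ≤ (if q < B then L else 1) * ((q : ℝ) ^ e) ^ δ := by
    intro q hq e
    have hq2 : (2 : ℝ) ≤ q := by exact_mod_cast hq.two_le
    have hcomm : ((q : ℝ) ^ e) ^ δ = ((q : ℝ) ^ δ) ^ e := by
      rw [← Real.rpow_natCast, ← Real.rpow_natCast, ← Real.rpow_mul (by positivity),
        ← Real.rpow_mul (by positivity), mul_comm]
    split_ifs with h
    · have h1 : ((2 : ℝ) ^ e) ^ δ ≤ ((q : ℝ) ^ e) ^ δ := by gcongr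
      have h2 : 1 + e * (δ * Real.log 2) ≤ ((2 : ℝ) ^ e) ^ δ := by
        rw [Real.rpow_def_of_pos (by positivity), Real.log_pow]
        have := Real.add_one_le_exp (e * Real.log 2 * δ)
        linarith
      have h3 : (e + 1 : ℝ) ≤ L * (1 + e * (δ * Real.log 2)) := by
        have h4 : L * (1 + e * (δ * Real.log 2)) =
            1 + e * (δ * Real.log 2) + 1 / (δ * Real.log 2) + e := by
          rw [hL]; field_simp; ring
        rw [h4]
        have : 0 ≤ e * (δ * Real.log 2) := by positivity
        have : 0 < 1 / (δ * Real.log 2) := by positivity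
        linarith
      calc (e + 1 : ℝ) ≤ _ := h3
        _ ≤ _ := by gcongr; linarith
    · rw [one_mul, hcomm]
      have hq' : (2 : ℝ) ^ (1 / δ) ≤ q := hB.trans (by exact_mod_cast not_lt.mp h)
      have h2 : (2 : ℝ) ≤ (q : ℝ) ^ δ := by
        calc (2 : ℝ) = ((2 : ℝ) ^ (1 / δ)) ^ δ := by
              rw [← Real.rpow_mul (by norm_num)]; field_simp; simp
          _ ≤ _ := by gcongr
      calc (e + 1 : ℝ) ≤ 2 ^ e := by exact_mod_cast Nat.lt_two_pow_self (n := e)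
        _ ≤ _ := by gcongr
  refine ⟨L ^ B, by positivity, fun n hn => ?_⟩
  rw [Nat.card_divisors hn]
  have hn' : (n : ℝ) ^ δ = ∏ q ∈ n.primeFactors, ((q : ℝ) ^ (n.factorization q)) ^ δ := by
    rw [Real.finsetProd_rpow _ _ (fun i _ => by positivity)]
    congr 1
    conv_lhs => rw [← Nat.prod_factorization_pow_eq_self hn]
    rw [Finsupp.prod, Nat.support_factorization]; push_cast; rfl
  rw [hn']
  push_cast
  calc (∏ q ∈ n.primeFactors, ((n.factorization q : ℝ) + 1))
      ≤ ∏ q ∈ n.primeFactors, ((if q < B then L else 1) * ((q : ℝ) ^ (n.factorization q)) ^ δ) := by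
        apply Finset.prod_le_prod
        · intros; positivity
        · intro q hq; exact key q (Nat.prime_of_mem_primeFactors hq) _
    _ = (∏ q ∈ n.primeFactors, (if q < B then L else 1)) * _ := Finset.prod_mul_distrib
    _ ≤ _ := by
        gcongr
        rw [← Finset.prod_filter, Finset.prod_const]
        apply pow_le_pow_right₀ hL1
        calc _ ≤ (Finset.range B).card := Finset.card_le_card (by
                intro q hq; simp at hq ⊢; exact hq.2)
          _ = B := by simp

/-- quadruples -/
def Quad (R : ℕ) (n : ℤ) : Finset ((ℤ × ℤ) × (ℤ × ℤ)) :=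
  (((Finset.Icc (-(R:ℤ)) R) ×ˢ (Finset.Icc (-(R:ℤ)) R)) ×ˢ
    ((Finset.Icc (-(R:ℤ)) R) ×ˢ (Finset.Icc (-(R:ℤ)) R))).filter
    (fun t => t.1.1 * t.1.2 - t.2.1 * t.2.2 = n)

theorem fiber_bound (m : ℤ) (hm : m ≠ 0) (s : Finset (ℤ × ℤ)) (hs : ∀ x ∈ s, x.1 * x.2 = m) :
    s.card ≤ 2 * m.natAbs.divisors.card := by
  have : s.card ≤ (m.natAbs.divisors ×ˢ (Finset.univ : Finset Bool)).card := by
    refine Finset.card_le_card_of_injOn (fun x => (x.1.natAbs, decide (0 ≤ x.1))) ?_ ?_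
    · intro x hx
      have := hs x hx
      have h1 : x.1 ≠ 0 := by intro h; rw [h, zero_mul] at this; exact hm this.symm
      have h2 : x.2 ≠ 0 := by intro h; rw [h, mul_zero] at this; exact hm this.symm
      simp [← this, Int.natAbs_mul, h1, h2, le_or_gt]
    · rintro ⟨a, b⟩ hx ⟨a', b'⟩ hy h
      have h1 := hs _ hx
      have h2 := hs _ hy
      simp only [Prod.mk.injEq, decide_eq_decide] at h h1 h2
      have : a = a' := by omega
      subst this
      have ha : a ≠ 0 := by rintro rfl; simp at h1; exact hm h1.symm
      rw [← h2] at h1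
      rw [mul_left_cancel₀ ha h1]
  simpa [mul_comm] using this

theorem quad_card (δ : ℝ) (hδ : 0 < δ) : ∃ K : ℝ, 0 < K ∧ ∀ (R : ℕ) (n : ℤ), 1 ≤ R → n ≠ 0 →
    |n| ≤ R ^ 2 → ((Quad R n).card : ℝ) ≤ K * (R : ℝ) ^ 2 * ((R : ℝ) ^ 2) ^ δ := by
  obtain ⟨K, hK, hd⟩ := divisor_bound δ hδ
  refine ⟨9 * (2 * K * 2 ^ δ) + 18, by positivity, fun R n hR hn hnR => ?_⟩
  set I := Finset.Icc (-(R:ℤ)) R with hI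
  have hIc : (I.card : ℝ) ≤ 3 * R := by
    have : I.card ≤ 3 * R := by simp [hI]; omega
    exact_mod_cast this
  have hRR : (1 : ℝ) ≤ R := by exact_mod_cast hR
  set X : ℝ := ((R : ℝ) ^ 2) ^ δ with hX
  have hX1 : 1 ≤ X := Real.one_le_rpow (one_le_pow₀ hRR) hδ.le
  set T1 := (Quad R n).filter (fun t => t.1.1 * t.1.2 ≠ n)
  set T2 := (Quad R n).filter (fun t => ¬ t.1.1 * t.1.2 ≠ n)
  have hsplit : (Quad R n).card = T1.card + T2.card :=
    (Finset.card_filter_add_card_filter_not _).symm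
  have h1 : (T1.card : ℝ) ≤ (I.card * I.card) * (2 * (K * (2 ^ δ * X))) := by
    have hmaps : ∀ t ∈ T1, t.1 ∈ I ×ˢ I := by
      intro t ht
      simp only [T1, Quad, Finset.mem_filter, Finset.mem_product] at ht
      simp only [Finset.mem_product, hI]; exact ht.1.1.1
    rw [Finset.card_eq_sum_card_fiberwise hmaps]
    push_cast
    rw [← Nat.cast_mul, ← Finset.card_product, ← nsmul_eq_mul]
    apply Finset.sum_le_card_nsmul
    rintro ⟨a, d⟩ had
    simp only [Finset.mem_product, hI, Finset.mem_Icc] at had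
    by_cases hm : a * d = n
    · have : (T1.filter (fun t => t.1 = (a, d))) = ∅ := by
        ext t
        simp only [T1, Finset.mem_filter, Finset.notMem_empty, iff_false]
        rintro ⟨⟨_, h⟩, h'⟩
        rw [h'] at h; exact h hm
      rw [this]; simp; positivity
    · have hm' : a * d - n ≠ 0 := sub_ne_zero.mpr hm
      have hc : (T1.filter (fun t => t.1 = (a, d))).card ≤ 2 * (a * d - n).natAbs.divisors.card := by
        rw [← Finset.card_image_of_injOn (f := Prod.snd)]
        · apply fiber_bound _ hm'
          intro x hx
          simp only [T1, Quad, Finset.mem_filter, Finset.mem_image] at hx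
          obtain ⟨t, ⟨⟨⟨_, h⟩, _⟩, h'⟩, rfl⟩ := hx
          rw [h'] at h; simp at h; linarith
        · rintro ⟨x, y⟩ hx ⟨x', y'⟩ hy h
          simp at hx hy h
          rw [hx.2, hy.2, h]
      calc ((T1.filter (fun t => t.1 = (a, d))).card : ℝ)
          ≤ 2 * (a * d - n).natAbs.divisors.card := by exact_mod_cast hc
        _ ≤ 2 * (K * ((a * d - n).natAbs : ℝ) ^ δ) := by
            gcongr; exact hd _ (by simpa using hm')
        _ ≤ _ := by
            rw [hX, ← Real.mul_rpow (by norm_num) (by positivity)]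
            gcongr
            rw [Nat.cast_natAbs]
            have : |a * d - n| ≤ 2 * (R : ℤ) ^ 2 := by
              have h3 : |a| ≤ R := abs_le.mpr had.1
              have h4 : |d| ≤ R := abs_le.mpr had.2
              calc |a * d - n| ≤ |a * d| + |n| := abs_sub _ _
                _ ≤ R * R + R ^ 2 := by rw [abs_mul]; gcongr
                _ = _ := by ring
            exact_mod_cast this
  have h2 : (T2.card : ℝ) ≤ 2 * (I.card * I.card) := by
    have : T2.card ≤ ((Finset.univ : Finset Bool) ×ˢ (I ×ˢ I)).card := by
      refine Finset.card_le_card_of_injOn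
        (fun t => (decide (t.2.1 = 0), (t.1.1, if t.2.1 = 0 then t.2.2 else t.2.1))) ?_ ?_
      · intro t ht
        simp only [T2, Quad, Finset.coe_filter, Finset.mem_filter, Finset.mem_product, Set.mem_ofPred_eq] at ht
        simp only [Finset.coe_product, Set.mem_prod, Finset.mem_coe]
        refine ⟨Finset.mem_univ _, ht.1.1.1.1, ?_⟩
        split_ifs
        · exact ht.1.1.2.2
        · exact ht.1.1.2.1
      · rintro ⟨⟨a, d⟩, ⟨b, c⟩⟩ ht ⟨⟨a', d'⟩, ⟨b', c'⟩⟩ ht' h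
        simp only [T2, Quad, Finset.coe_filter, Finset.mem_filter, Set.mem_ofPred_eq, not_not] at ht ht'
        simp only [Prod.mk.injEq, decide_eq_decide] at h
        obtain ⟨h0, rfl, h5⟩ := h
        have e1 := ht.2
        have e2 := ht'.2
        have ha : a ≠ 0 := by rintro rfl; simp at e1; exact hn e1.symm
        have hdd : d = d' := mul_left_cancel₀ ha (e1.trans e2.symm)
        have f1 : b * c = 0 := by have := ht.1.2; linarith
        have f2 : b' * c' = 0 := by have := ht'.1.2; linarith
        subst hdd
        by_cases hb : b = 0
        · have hb' := h0.mp hb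
          simp [hb, hb'] at h5 ⊢; exact h5
        · have hb' : b' ≠ 0 := fun h => hb (h0.mpr h)
          simp [hb, hb'] at h5 f1 f2
          simp [h5, f1, f2]
    simp only [Finset.card_product, Finset.card_univ, Fintype.card_bool] at this
    exact_mod_cast this
  have hII : (I.card * I.card : ℝ) ≤ 9 * R ^ 2 := by
    calc (I.card * I.card : ℝ) ≤ (3 * R) * (3 * R) := by gcongr
      _ = _ := by ring
  rw [hsplit]; push_cast
  calc (T1.card : ℝ) + T2.card
      ≤ (9 * R ^ 2) * (2 * (K * (2 ^ δ * X))) + 2 * (9 * R ^ 2) * 1 := by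
        refine add_le_add (h1.trans (by gcongr)) (by linarith)
    _ ≤ (9 * R ^ 2) * (2 * (K * (2 ^ δ * X))) + 2 * (9 * R ^ 2) * X := by gcongr
    _ = _ := by ring

theorem sl_dist (γ : SL(2, ℚ)) (x y : ℍ) : dist (γ • x) (γ • y) = dist x y := by
  have h : ∀ x : ℍ, γ • x = (γ.map (algebraMap ℚ ℝ)) • x := fun x => by
    ext1
    rw [coe_specialLinearGroup_apply, coe_specialLinearGroup_apply]
    simp
  rw [h, h, dist_smul]

theorem lin_bound (w : ℍ) (x y L : ℝ) (h : ‖(x : ℂ) * w + y‖ ≤ L) :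
    |x| ≤ L / w.im ∧ |y| ≤ L + L / w.im * ‖(w : ℂ)‖ := by
  have hx : |x| ≤ L / w.im := by
    rw [le_div_iff₀ w.im_pos]
    have h1 := (Complex.abs_im_le_norm ((x : ℂ) * w + y)).trans h
    simpa [abs_mul, abs_of_pos w.im_pos] using h1
  refine ⟨hx, ?_⟩
  calc |y| = ‖((x : ℂ) * w + y) - x * w‖ := by simp
    _ ≤ ‖(x : ℂ) * w + y‖ + ‖(x : ℂ) * w‖ := norm_sub_le _ _
    _ ≤ _ := by
      rw [norm_mul, Complex.norm_real, Real.norm_eq_abs]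
      gcongr

theorem entry_bound (w : ℍ) (M : ℕ) : ∃ C : ℕ, 1 ≤ C ∧ ∀ (γ : SL(2, ℚ)) (z : ℍ),
    ‖(z : ℂ)‖ ≤ M → 1 ≤ M * z.im → dist (γ⁻¹ • z) w ≤ 1 →
    ∀ i j, |((γ.1 i j : ℚ) : ℝ)| ≤ C := by
  set E := Real.exp 1
  have hE1 : 1 ≤ E := Real.one_le_exp (by norm_num)
  set Q : ℝ := √(w.im * (M * E))
  set L : ℝ := max Q (M * E * Q)
  obtain ⟨C, hC⟩ := exists_nat_ge (max 1 (max (L / w.im) (L + L / w.im * ‖(w : ℂ)‖)))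
  have hC1 : (1 : ℝ) ≤ C := (le_max_left _ _).trans hC
  have hC2 : L / w.im ≤ C := ((le_max_left _ _).trans (le_max_right _ _)).trans hC
  have hC3 : L + L / w.im * ‖(w : ℂ)‖ ≤ C := ((le_max_right _ _).trans (le_max_right _ _)).trans hC
  refine ⟨C, by exact_mod_cast hC1, fun γ z hz hzi hd => ?_⟩
  have hd' : dist (γ • w) z ≤ 1 := by
    rw [← sl_dist γ, smul_inv_smul, dist_comm] at hd; exact hd
  set u := γ • w with hu
  have hM : (0 : ℝ) < M := by
    by_contra h
    have : (M : ℝ) = 0 := le_antisymm (not_lt.mp h) (by positivity)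
    rw [this] at hzi; norm_num at hzi
  have him : 1 ≤ M * E * u.im := by
    have h1 := im_le_im_mul_exp_dist z u
    have h2 : Real.exp (dist z u) ≤ E := Real.exp_le_exp.mpr (by rw [dist_comm]; exact hd')
    have h3 : z.im ≤ u.im * E := h1.trans (by gcongr)
    calc 1 ≤ M * z.im := hzi
      _ ≤ M * (u.im * E) := by gcongr
      _ = _ := by ring
  have hun : ‖(u : ℂ)‖ ≤ M * E := by
    have h1 := dist_coe_le u z
    have h2 : Real.exp (dist u z) ≤ E := Real.exp_le_exp.mpr hd'
    have h3 : z.im ≤ M := (le_abs_self _).trans ((Complex.abs_im_le_norm (z : ℂ)).trans hz)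
    have h4 : ‖(u : ℂ)‖ ≤ ‖(z : ℂ)‖ + dist (u : ℂ) z := by
      rw [dist_eq_norm]
      calc ‖(u : ℂ)‖ = ‖(z : ℂ) + (u - z)‖ := by ring_nf
        _ ≤ _ := norm_add_le _ _
    have h5 : z.im * (Real.exp (dist u z) - 1) ≤ M * (E - 1) := by
      have : 0 ≤ Real.exp (dist u z) - 1 := by
        have := Real.one_le_exp (dist_nonneg (x := u) (y := z)); linarith
      gcongr
    linarith
  set a : ℝ := ((γ.1 0 0 : ℚ) : ℝ) with ha
  set b : ℝ := ((γ.1 0 1 : ℚ) : ℝ) with hb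
  set c : ℝ := ((γ.1 1 0 : ℚ) : ℝ) with hc
  set d : ℝ := ((γ.1 1 1 : ℚ) : ℝ) with hdd
  have hdet : a * d - b * c = 1 := by
    have := γ.2
    rw [Matrix.det_fin_two] at this
    rw [ha, hb, hc, hdd]; exact_mod_cast this
  have huc : (u : ℂ) = ((a : ℂ) * w + b) / ((c : ℂ) * w + d) := by
    rw [hu, coe_specialLinearGroup_apply]; simp [ha, hb, hc, hdd]
  have hne : (c : ℂ) * w + d ≠ 0 := by
    intro h
    rw [h, div_zero] at huc
    exact u.ne_zero huc
  have hnum : (u : ℂ) * ((c : ℂ) * w + d) = (a : ℂ) * w + b := by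
    rw [huc, div_mul_cancel₀ _ hne]
  have himq : u.im * ‖(c : ℂ) * w + d‖ ^ 2 = w.im := by
    rw [← coe_im, huc, Complex.div_im, ← Complex.normSq_eq_norm_sq]
    have : Complex.normSq ((c : ℂ) * w + d) ≠ 0 := by simpa using hne
    rw [← sub_div, div_mul_cancel₀ _ this]
    simp
    linear_combination w.im * hdet
  have hden : ‖(c : ℂ) * w + d‖ ≤ Q := by
    apply Real.le_sqrt_of_sq_le
    calc ‖(c : ℂ) * w + d‖ ^ 2 = 1 * ‖(c : ℂ) * w + d‖ ^ 2 := by ring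
      _ ≤ (M * E * u.im) * ‖(c : ℂ) * w + d‖ ^ 2 := by gcongr
      _ = (M * E) * (u.im * ‖(c : ℂ) * w + d‖ ^ 2) := by ring
      _ = _ := by rw [himq]; ring
  have hnu : ‖(a : ℂ) * w + b‖ ≤ M * E * Q := by
    rw [← hnum, norm_mul]; gcongr
  have r1 := lin_bound w c d L (hden.trans (le_max_left _ _))
  have r2 := lin_bound w a b L (hnu.trans (le_max_right _ _))
  intro i j
  fin_cases i <;> fin_cases j
  · exact r2.1.trans hC2
  · exact r2.2.trans hC3
  · exact r1.1.trans hC2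
  · exact r1.2.trans hC3

theorem int_of_ht (p : ℕ) (hp : p.Prime) (γ : Matrix (Fin 2) (Fin 2) ℚ)
    (h : ∀ i j, IsZInvP p (γ i j)) (k : ℕ) (hk : ht p γ ≤ k) :
    IsIntMat ((p : ℚ) ^ k • γ) := by
  have hp0 : (p : ℚ) ≠ 0 := by exact_mod_cast hp.ne_zero
  have hne : {k : ℕ | IsIntMat ((p : ℚ) ^ k • γ)}.Nonempty := by
    choose a m ham using h
    refine ⟨∑ i, ∑ j, m i j, fun i j => ?_⟩
    have hle : m i j ≤ ∑ i, ∑ j, m i j :=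
      (Finset.single_le_sum (f := fun j => m i j) (fun _ _ => Nat.zero_le _) (Finset.mem_univ j)).trans
      (Finset.single_le_sum (f := fun i => ∑ j, m i j) (fun _ _ => Nat.zero_le _) (Finset.mem_univ i))
    obtain ⟨r, hr⟩ := Nat.exists_eq_add_of_le hle
    refine ⟨p ^ r * a i j, ?_⟩
    rw [Matrix.smul_apply, hr, ham, smul_eq_mul, pow_add]
    push_cast; field_simp
  have hmem := Nat.sInf_mem hne
  obtain ⟨r, hr⟩ := Nat.exists_eq_add_of_le hk
  intro i j
  obtain ⟨x, hx⟩ := hmem i j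
  refine ⟨p ^ r * x, ?_⟩
  push_cast
  rw [← hx, hr, Matrix.smul_apply, Matrix.smul_apply, smul_eq_mul, smul_eq_mul, pow_add]
  unfold ht; ring

theorem piece_volume (γ : SL(2, ℚ)) (w : ℍ) (M : ℕ) (ε : ℝ) (hε : 0 ≤ ε) (hε1 : ε ≤ 1) :
    volume {q : ℂ | ∃ z : ℍ, (z : ℂ) = q ∧ ‖(z : ℂ)‖ ≤ M ∧ dist (γ⁻¹ • z) w ≤ ε} ≤
      ENNReal.ofReal ((18 * M) ^ 2 * Real.pi * ε ^ 2) := by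
  set S := {q : ℂ | ∃ z : ℍ, (z : ℂ) = q ∧ ‖(z : ℂ)‖ ≤ M ∧ dist (γ⁻¹ • z) w ≤ ε} with hS
  rcases S.eq_empty_or_nonempty with h | ⟨q0, z0, rfl, hz0, hd0⟩
  · rw [h]; simp
  have hsub : S ⊆ Metric.closedBall (z0 : ℂ) (18 * M * ε) := by
    rintro q ⟨z, rfl, hz, hd⟩
    have h1 : dist z z0 ≤ 2 * ε := by
      rw [← sl_dist γ⁻¹]
      have := dist_triangle_right (γ⁻¹ • z) (γ⁻¹ • z0) w
      linarith
    have h2 := dist_coe_le z z0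
    have h3 : z0.im ≤ M := (le_abs_self _).trans ((Complex.abs_im_le_norm (z0 : ℂ)).trans hz0)
    have h4 : Real.exp (dist z z0) ≤ Real.exp (2 * ε) := Real.exp_le_exp.mpr h1
    have h5 : Real.exp (2 * ε) - 1 ≤ 18 * ε := by
      have e1 : Real.exp (2 * ε) ≤ 9 := by
        calc Real.exp (2 * ε) ≤ Real.exp (1 + 1) := Real.exp_le_exp.mpr (by linarith)
          _ = Real.exp 1 * Real.exp 1 := Real.exp_add _ _
          _ ≤ 3 * 3 := by
            have := Real.exp_one_lt_d9
            gcongr <;> linarith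
          _ = 9 := by norm_num
      have e2 := Real.add_one_le_exp (-(2 * ε))
      have e3 : Real.exp (-(2 * ε)) * Real.exp (2 * ε) = 1 := by
        rw [← Real.exp_add]; simp
      have e4 := Real.exp_pos (2 * ε)
      nlinarith
    rw [Metric.mem_closedBall]
    calc dist (z : ℂ) z0 ≤ z0.im * (Real.exp (dist z z0) - 1) := h2
      _ ≤ z0.im * (18 * ε) := by
        have := z0.im_pos
        gcongr; linarith
      _ ≤ M * (18 * ε) := by gcongr
      _ = _ := by ring
  refine (measure_mono hsub).trans (le_of_eq ?_)
  rw [Complex.volume_closedBall, ← ENNReal.ofReal_pow (by positivity),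
    ← ENNReal.ofReal_coe_nnreal, NNReal.coe_real_pi, ← ENNReal.ofReal_mul (by positivity)]
  congr 1; ring

/-- Points of the compact region of index `M` that are well approximated at height at most `k`. -/
def Eset (p : ℕ) (w : ℍ) (ζ : ℝ) (M k : ℕ) : Set ℂ :=
  {q : ℂ | ∃ z : ℍ, (z : ℂ) = q ∧ ‖(z : ℂ)‖ ≤ M ∧ 1 ≤ M * z.im ∧
    ∃ γ : SL(2, ℚ), IsIntMat ((p : ℚ) ^ k • γ.1) ∧ dist (γ⁻¹ • z) w ≤ (p : ℝ) ^ (-(k / ζ))}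

/-- The integer quadruple `t` represents `p ^ k • γ`. -/
def QuadRep (p k : ℕ) (γ : SL(2, ℚ)) (t : (ℤ × ℤ) × (ℤ × ℤ)) : Prop :=
  (p : ℚ) ^ k * γ.1 0 0 = t.1.1 ∧ (p : ℚ) ^ k * γ.1 1 1 = t.1.2 ∧
  (p : ℚ) ^ k * γ.1 0 1 = t.2.1 ∧ (p : ℚ) ^ k * γ.1 1 0 = t.2.2

theorem QuadRep.unique {p k : ℕ} (hp : p.Prime) {γ γ' : SL(2, ℚ)} {t : (ℤ × ℤ) × (ℤ × ℤ)}
    (h : QuadRep p k γ t) (h' : QuadRep p k γ' t) : γ = γ' := by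
  have hp0 : (p : ℚ) ^ k ≠ 0 := pow_ne_zero _ (by exact_mod_cast hp.ne_zero)
  obtain ⟨h1, h2, h3, h4⟩ := h
  obtain ⟨g1, g2, g3, g4⟩ := h'
  apply Matrix.SpecialLinearGroup.ext
  intro i j
  apply mul_left_cancel₀ hp0
  fin_cases i <;> fin_cases j
  · exact h1.trans g1.symm
  · exact h3.trans g3.symm
  · exact h4.trans g4.symm
  · exact h2.trans g2.symm

theorem E_volume (p : ℕ) (hp : p.Prime) (w : ℍ) (ζ : ℝ) (h0 : 0 < ζ) (h1 : ζ < 1) (M : ℕ) :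
    ∃ D r : ℝ, 0 ≤ D ∧ 0 ≤ r ∧ r < 1 ∧
      ∀ k, volume (Eset p w ζ M k) ≤ ENNReal.ofReal (D * r ^ k) := by
  obtain ⟨C, hC1, hC⟩ := entry_bound w M
  set δ : ℝ := (1 / ζ - 1) / 2 with hδ
  have hζ1 : 1 < 1 / ζ := by rw [lt_div_iff₀ h0]; linarith
  have hδ0 : 0 < δ := by rw [hδ]; linarith
  obtain ⟨K, hK, hq⟩ := quad_card δ hδ0
  have hp1 : (1 : ℝ) < p := by exact_mod_cast hp.one_lt
  have hpp : (0 : ℝ) < p := by linarith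
  refine ⟨K * C ^ 2 * ((C : ℝ) ^ 2) ^ δ * ((18 * M) ^ 2 * Real.pi),
    (p : ℝ) ^ (2 + 2 * δ - 2 / ζ), by positivity, by positivity, ?_, fun k => ?_⟩
  · apply Real.rpow_lt_one_of_one_lt_of_neg hp1
    have : 2 / ζ = 2 * (1 / ζ) := by ring
    rw [hδ, this]; linarith
  set ε : ℝ := (p : ℝ) ^ (-(k / ζ)) with hε
  have hε0 : 0 < ε := by positivity
  have hε1 : ε ≤ 1 := by
    apply Real.rpow_le_one_of_one_le_of_nonpos hp1.le
    have : 0 ≤ k / ζ := by positivity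
    linarith
  set R : ℕ := C * p ^ k with hR
  set n : ℤ := (p : ℤ) ^ (2 * k) with hn
  classical
  let g : (ℤ × ℤ) × (ℤ × ℤ) → SL(2, ℚ) := fun t => if h : ∃ γ, QuadRep p k γ t then h.choose else 1
  have hsub : Eset p w ζ M k ⊆ ⋃ t ∈ Quad R n,
      {q : ℂ | ∃ z : ℍ, (z : ℂ) = q ∧ ‖(z : ℂ)‖ ≤ M ∧ dist ((g t)⁻¹ • z) w ≤ ε} := by
    rintro q ⟨z, rfl, hz, hzi, γ, hγ, hd⟩
    have hb := hC γ z hz hzi (hd.trans hε1)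
    choose a ha using hγ
    simp only [Matrix.smul_apply, smul_eq_mul] at ha
    have hab : ∀ i j, a i j ∈ Finset.Icc (-(R : ℤ)) R := by
      intro i j
      rw [Finset.mem_Icc, ← abs_le]
      have e1 : ((a i j : ℤ) : ℝ) = (p : ℝ) ^ k * ((γ.1 i j : ℚ) : ℝ) := by
        have := ha i j
        exact_mod_cast this.symm
      have e2 : |((a i j : ℤ) : ℝ)| ≤ C * (p : ℝ) ^ k := by
        rw [e1, abs_mul, abs_of_pos (by positivity), mul_comm]
        gcongr; exact hb i j
      rw [hR]; exact_mod_cast e2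
    set t : (ℤ × ℤ) × (ℤ × ℤ) := ((a 0 0, a 1 1), (a 0 1, a 1 0)) with ht
    have hrep : QuadRep p k γ t := ⟨ha 0 0, ha 1 1, ha 0 1, ha 1 0⟩
    have hgt : g t = γ := by
      have hex : ∃ γ, QuadRep p k γ t := ⟨γ, hrep⟩
      have : g t = hex.choose := dif_pos hex
      rw [this]
      exact QuadRep.unique hp hex.choose_spec hrep
    simp only [Set.mem_iUnion]
    refine ⟨t, ?_, z, rfl, hz, by rw [hgt]; exact hd⟩
    simp only [Quad, Finset.mem_filter, Finset.mem_product]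
    refine ⟨⟨⟨hab _ _, hab _ _⟩, ⟨hab _ _, hab _ _⟩⟩, ?_⟩
    have hdet := γ.2
    rw [Matrix.det_fin_two] at hdet
    have : ((a 0 0 : ℤ) : ℚ) * a 1 1 - a 0 1 * a 1 0 = (p : ℚ) ^ (2 * k) := by
      rw [← ha, ← ha, ← ha, ← ha]
      linear_combination (p : ℚ) ^ (2 * k) * hdet
    rw [hn]; exact_mod_cast this
  have hcard : ((Quad R n).card : ℝ) ≤ K * (R : ℝ) ^ 2 * ((R : ℝ) ^ 2) ^ δ := by
    apply hq
    · exact Nat.one_le_iff_ne_zero.mpr (by have := hp.ne_zero; positivity)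
    · have := hp.ne_zero; positivity
    · rw [hn, abs_of_nonneg (by positivity), hR]
      push_cast
      rw [mul_pow, ← pow_mul, mul_comm k 2]
      have : (1 : ℤ) ≤ (C : ℤ) ^ 2 := one_le_pow₀ (by exact_mod_cast hC1)
      exact le_mul_of_one_le_left (by positivity) this
  have hRδ : (R : ℝ) ^ 2 * ((R : ℝ) ^ 2) ^ δ * ε ^ 2 =
      C ^ 2 * ((C : ℝ) ^ 2) ^ δ * ((p : ℝ) ^ (2 + 2 * δ - 2 / ζ)) ^ k := by
    have e1 : (R : ℝ) ^ 2 = C ^ 2 * (p : ℝ) ^ ((2 : ℝ) * k) := by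
      rw [hR]; push_cast
      rw [mul_pow, ← pow_mul, mul_comm k 2, ← Real.rpow_natCast (p : ℝ) (2 * k)]; push_cast; rfl
    have e2 : ε ^ 2 = (p : ℝ) ^ (-(k / ζ) * 2) := by
      rw [hε, ← Real.rpow_natCast, ← Real.rpow_mul hpp.le]; norm_num
    rw [e1, e2, Real.mul_rpow (by positivity) (by positivity), ← Real.rpow_mul hpp.le,
      ← Real.rpow_natCast ((p : ℝ) ^ (2 + 2 * δ - 2 / ζ)), ← Real.rpow_mul hpp.le]
    have e3 : (2 + 2 * δ - 2 / ζ) * (k : ℝ) = (2 * k) + (2 * k * δ) + (-(k / ζ) * 2) := by ring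
    rw [e3, Real.rpow_add hpp, Real.rpow_add hpp]
    ring
  calc volume (Eset p w ζ M k) ≤ volume (⋃ t ∈ Quad R n,
      {q : ℂ | ∃ z : ℍ, (z : ℂ) = q ∧ ‖(z : ℂ)‖ ≤ M ∧ dist ((g t)⁻¹ • z) w ≤ ε}) :=
        measure_mono hsub
    _ ≤ ∑ t ∈ Quad R n, volume
        {q : ℂ | ∃ z : ℍ, (z : ℂ) = q ∧ ‖(z : ℂ)‖ ≤ M ∧ dist ((g t)⁻¹ • z) w ≤ ε} :=
        measure_biUnion_finset_le _ _
    _ ≤ ∑ t ∈ Quad R n, ENNReal.ofReal ((18 * M) ^ 2 * Real.pi * ε ^ 2) :=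
        Finset.sum_le_sum fun t _ => piece_volume _ _ _ _ hε0.le hε1
    _ = ENNReal.ofReal ((Quad R n).card * ((18 * M) ^ 2 * Real.pi * ε ^ 2)) := by
        rw [Finset.sum_const, nsmul_eq_mul, ENNReal.ofReal_mul (Nat.cast_nonneg (Quad R n).card),
          ENNReal.ofReal_natCast]
    _ ≤ _ := by
        apply ENNReal.ofReal_le_ofReal
        calc ((Quad R n).card : ℝ) * ((18 * M) ^ 2 * Real.pi * ε ^ 2)
            ≤ (K * (R : ℝ) ^ 2 * ((R : ℝ) ^ 2) ^ δ) * ((18 * M) ^ 2 * Real.pi * ε ^ 2) := by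
              gcongr
          _ = K * ((18 * M) ^ 2 * Real.pi) * ((R : ℝ) ^ 2 * ((R : ℝ) ^ 2) ^ δ * ε ^ 2) := by ring
          _ = _ := by rw [hRδ]; ring

theorem E_null (p : ℕ) (hp : p.Prime) (w : ℍ) (ζ : ℝ) (h0 : 0 < ζ) (h1 : ζ < 1) (M : ℕ) :
    volume {q : ℂ | ∃ᶠ k in Filter.atTop, q ∈ Eset p w ζ M k} = 0 := by
  obtain ⟨D, r, hD, hr, hr1, hk⟩ := E_volume p hp w ζ h0 h1 M
  apply measure_setOfPred_frequently_eq_zero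
  refine ne_top_of_le_ne_top ?_ (ENNReal.tsum_le_tsum hk)
  exact ((summable_geometric_of_lt_one hr hr1).mul_left D).tsum_ofReal_ne_top

/-- The `n = 2` case of the lower bound `κ(z, w) ≥ 1` for the Diophantine exponent:
for every `w ∈ ℍ` and almost every `z ∈ ℍ`, for every `0 < ζ < 1` and every `ε₀ > 0`
there is `0 < ε < ε₀` such that every `γ ∈ SL₂(ℤ[1/p])` with
`ht γ ≤ ζ · log (ε⁻¹) / log p` satisfies `dist (γ⁻¹ • z, w) > ε`. -/
theorem stmt1 (p : ℕ) (hp : p.Prime) (w : ℍ) :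
    volume {q : ℂ | ∃ z : ℍ, (z : ℂ) = q ∧
      ¬ (∀ ζ : ℝ, 0 < ζ → ζ < 1 → ∀ ε₀ : ℝ, 0 < ε₀ → ∃ ε : ℝ, 0 < ε ∧ ε < ε₀ ∧
        ∀ γ : SL(2, ℚ), (∀ i j, IsZInvP p (γ.1 i j)) →
          (ht p γ.1 : ℝ) ≤ ζ * Real.log ε⁻¹ / Real.log p →
          ε < dist (γ⁻¹ • z) w)} = 0 := by
  have hp1 : (1 : ℝ) < p := by exact_mod_cast hp.one_lt
  have hpp : (0 : ℝ) < p := by linarith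
  have hlog : 0 < Real.log p := Real.log_pos hp1
  have hζm : ∀ m : ℕ, 0 < 1 - 1 / ((m : ℝ) + 2) ∧ 1 - 1 / ((m : ℝ) + 2) < 1 := by
    intro m
    have h2 : 0 < 1 / ((m : ℝ) + 2) := by positivity
    have h3 : 1 / ((m : ℝ) + 2) < 1 := by
      rw [div_lt_one (by positivity)]
      have : (0 : ℝ) ≤ m := by positivity
      linarith
    constructor <;> linarith
  have hnull : volume (⋃ m : ℕ, ⋃ M : ℕ,
      {q : ℂ | ∃ᶠ k in Filter.atTop, q ∈ Eset p w (1 - 1 / ((m : ℝ) + 2)) M k}) = 0 := by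
    rw [measure_iUnion_null_iff]; intro m
    rw [measure_iUnion_null_iff]; intro M
    exact E_null p hp w _ (hζm m).1 (hζm m).2 M
  refine measure_mono_null ?_ hnull
  rintro q ⟨z, rfl, hbad⟩
  push Not at hbad
  obtain ⟨ζ, h0, h1, ε₀, hε₀, hbad⟩ := hbad
  obtain ⟨m, hm⟩ := exists_nat_ge (1 / (1 - ζ))
  obtain ⟨M, hM⟩ := exists_nat_ge (max ‖(z : ℂ)‖ (1 / z.im))
  set ζ' : ℝ := 1 - 1 / ((m : ℝ) + 2) with hζ'
  obtain ⟨hz0, hz1⟩ := hζm m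
  have hζζ : ζ ≤ ζ' := by
    have h2 : 0 < 1 - ζ := by linarith
    have h3 : 1 / ((m : ℝ) + 2) ≤ 1 - ζ := by
      rw [div_le_iff₀ (by positivity)]
      rw [div_le_iff₀ h2] at hm
      nlinarith
    rw [hζ']; linarith
  simp only [Set.mem_iUnion]
  refine ⟨m, M, ?_⟩
  apply Filter.Eventually.frequently
  have htend : Filter.Tendsto (fun k : ℕ => (p : ℝ) ^ (-((k : ℝ) / ζ'))) Filter.atTop (nhds 0) := by
    have h2 : Filter.Tendsto (fun k : ℕ => ((p : ℝ) ^ (-(1 / ζ'))) ^ k) Filter.atTop (nhds 0) := by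
      apply tendsto_pow_atTop_nhds_zero_of_lt_one (by positivity)
      apply Real.rpow_lt_one_of_one_lt_of_neg hp1
      have : 0 < 1 / ζ' := by positivity
      linarith
    refine h2.congr fun k => ?_
    rw [← Real.rpow_natCast, ← Real.rpow_mul hpp.le]
    congr 1; ring
  filter_upwards [htend.eventually (gt_mem_nhds hε₀)] with k hk
  obtain ⟨γ, hγ, hht, hd⟩ := hbad _ (by positivity) hk
  refine ⟨z, rfl, (le_max_left _ _).trans hM, ?_, γ, ?_, hd⟩
  · have := (le_max_right _ _).trans hM
    rwa [div_le_iff₀ z.im_pos] at this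
  · apply int_of_ht p hp _ hγ
    have h2 : ζ * Real.log ((p : ℝ) ^ (-((k : ℝ) / ζ')))⁻¹ / Real.log p = ζ * (k / ζ') := by
      rw [Real.log_inv, Real.log_rpow hpp]; field_simp
    rw [h2] at hht
    have h3 : ζ * (k / ζ') ≤ k := by
      rw [← mul_div_assoc, div_le_iff₀ hz0, mul_comm]; gcongr
    exact_mod_cast hht.trans h3
end
end

section
/- Let p be a prime and n ≥ 2 an integer. There exist constants c, C > 0 (depending only on n and p) such that for every l ∈ ℕ the set of orbits of SL_n(ℤ) acting by right multiplication on R(p^l) = {A ∈ Mat_n(ℤ) : det A = p^l} is finite, and its cardinality N_l satisfies c · p^{l(n−1)} ≤ N_l ≤ C · p^{l(n−1)}. -/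
open Matrix

noncomputable section

/-- `R(p^l)`: the set of `n × n` integer matrices of determinant `p ^ l`. -/
def Rset (p n l : ℕ) : Set (Matrix (Fin n) (Fin n) ℤ) := {A | A.det = (p : ℤ) ^ l}

/-- The relation of lying in the same orbit of the right-multiplication action of
`SL_n(ℤ)` on `R(p^l)`. -/
def orbRel (p n l : ℕ) (A B : Rset p n l) : Prop :=
  ∃ s : Matrix.SpecialLinearGroup (Fin n) ℤ,
    (B : Matrix (Fin n) (Fin n) ℤ) =
      (A : Matrix (Fin n) (Fin n) ℤ) * (s : Matrix (Fin n) (Fin n) ℤ)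

/-- Block matrix with corner `d`, first row `r`, first column `w` and lower block `B`. -/
def blk {n : ℕ} (d : ℤ) (r w : Fin n → ℤ) (B : Matrix (Fin n) (Fin n) ℤ) :
    Matrix (Fin (n + 1)) (Fin (n + 1)) ℤ :=
  Matrix.of (Fin.cons (Fin.cons d r) (fun i => Fin.cons (w i) (B i)))

@[simp] lemma blk_zz {n : ℕ} (d : ℤ) (r w : Fin n → ℤ) (B : Matrix (Fin n) (Fin n) ℤ) :
    blk d r w B 0 0 = d := rfl
@[simp] lemma blk_zs {n : ℕ} (d : ℤ) (r w : Fin n → ℤ) (B : Matrix (Fin n) (Fin n) ℤ)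
    (j : Fin n) : blk d r w B 0 j.succ = r j := rfl
@[simp] lemma blk_sz {n : ℕ} (d : ℤ) (r w : Fin n → ℤ) (B : Matrix (Fin n) (Fin n) ℤ)
    (i : Fin n) : blk d r w B i.succ 0 = w i := rfl
@[simp] lemma blk_ss {n : ℕ} (d : ℤ) (r w : Fin n → ℤ) (B : Matrix (Fin n) (Fin n) ℤ)
    (i j : Fin n) : blk d r w B i.succ j.succ = B i j := rfl

lemma det_blk_row {n : ℕ} (d : ℤ) (w : Fin n → ℤ) (B : Matrix (Fin n) (Fin n) ℤ) :
    (blk d 0 w B).det = d * B.det := by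
  rw [Matrix.det_succ_row_zero, Fin.sum_univ_succ]
  simp
  left
  congr 1

lemma det_blk_col {n : ℕ} (d : ℤ) (r : Fin n → ℤ) (B : Matrix (Fin n) (Fin n) ℤ) :
    (blk d r 0 B).det = d * B.det := by
  rw [Matrix.det_succ_column_zero, Fin.sum_univ_succ]
  simp
  left
  congr 1

lemma blk_mul {n : ℕ} (d : ℤ) (w u : Fin n → ℤ) (B s : Matrix (Fin n) (Fin n) ℤ) :
    blk d 0 w B * blk 1 0 u s = blk d 0 (w + B *ᵥ u) (B * s) := by
  ext i j
  rw [Matrix.mul_apply, Fin.sum_univ_succ]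
  induction i using Fin.cases <;> induction j using Fin.cases <;>
    simp [Matrix.mul_apply, Matrix.mulVec, dotProduct]

lemma blk_eta {n : ℕ} (A : Matrix (Fin (n + 1)) (Fin (n + 1)) ℤ) :
    A = blk (A 0 0) (fun j => A 0 j.succ) (fun i => A i.succ 0)
      (Matrix.of fun i j => A i.succ j.succ) := by
  ext i j
  induction i using Fin.cases <;> induction j using Fin.cases <;> simp

/-- Right equivalence by determinant one matrices. -/
def REq {n : ℕ} (A B : Matrix (Fin n) (Fin n) ℤ) : Prop :=
  ∃ s : Matrix (Fin n) (Fin n) ℤ, s.det = 1 ∧ B = A * s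

lemma REq.trans {n : ℕ} {A B C : Matrix (Fin n) (Fin n) ℤ} (h : REq A B) (h' : REq B C) :
    REq A C := by
  obtain ⟨s, hs, rfl⟩ := h
  obtain ⟨t, ht, rfl⟩ := h'
  exact ⟨s * t, by simp [hs, ht], by rw [Matrix.mul_assoc]⟩

lemma REq.refl {n : ℕ} (A : Matrix (Fin n) (Fin n) ℤ) : REq A A := ⟨1, by simp, by simp⟩

lemma REq.det {n : ℕ} {A B : Matrix (Fin n) (Fin n) ℤ} (h : REq A B) : B.det = A.det := by
  obtain ⟨s, hs, rfl⟩ := h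
  simp [hs]

/-- Column operation: add `c` times column `i` to column `j`. -/
lemma REq.col {n : ℕ} (A : Matrix (Fin n) (Fin n) ℤ) (i j : Fin n) (h : i ≠ j) (c : ℤ) :
    ∃ B, REq A B ∧ (∀ a, B a j = A a j + c * A a i) ∧ ∀ a b, b ≠ j → B a b = A a b :=
  ⟨A * Matrix.transvection i j c, ⟨_, Matrix.det_transvection_of_ne i j h c, rfl⟩,
    fun a => Matrix.mul_transvection_apply_same i j a c A,
    fun a b hb => Matrix.mul_transvection_apply_of_ne i j a b hb c A⟩

lemma exists_pos {n : ℕ} (A : Matrix (Fin (n + 2)) (Fin (n + 2)) ℤ) (hA : A.det ≠ 0) :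
    ∃ B, REq A B ∧ 0 < B 0 0 := by
  have key : ∀ A : Matrix (Fin (n + 2)) (Fin (n + 2)) ℤ, ∀ j, j ≠ 0 → A 0 j ≠ 0 →
      ∃ B, REq A B ∧ 0 < B 0 0 := by
    intro A j hj h
    obtain ⟨B, hB, h1, -⟩ := REq.col A j 0 hj (A 0 j * (|A 0 0| + 1))
    refine ⟨B, hB, ?_⟩
    rw [h1]
    have h2 : 1 ≤ A 0 j * A 0 j := by
      have := mul_self_pos.mpr h
      omega
    have h3 := neg_abs_le (A 0 0)
    nlinarith [abs_nonneg (A 0 0)]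
  have hrow : ∃ j, A 0 j ≠ 0 := by
    by_contra hc
    push Not at hc
    exact hA (Matrix.det_eq_zero_of_row_eq_zero 0 hc)
  obtain ⟨j, hj⟩ := hrow
  by_cases hj0 : ∃ j, j ≠ 0 ∧ A 0 j ≠ 0
  · obtain ⟨j, h, h'⟩ := hj0
    exact key A j h h'
  · push Not at hj0
    have : j = 0 := by
      by_contra h
      exact hj (hj0 j h)
    subst this
    obtain ⟨B, hB, h1, -⟩ := REq.col A 0 1 (by simp) 1
    obtain ⟨C, hC, h⟩ := key B 1 (by simp) (by rw [h1, hj0 1 (by simp)]; simpa using hj)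
    exact ⟨C, hB.trans hC, h⟩

lemma exists_row {n : ℕ} (A : Matrix (Fin (n + 2)) (Fin (n + 2)) ℤ) (hA : A.det ≠ 0) :
    ∃ (d : ℤ) (w : Fin (n + 1) → ℤ) (B : Matrix (Fin (n + 1)) (Fin (n + 1)) ℤ),
      0 < d ∧ REq A (blk d 0 w B) := by
  classical
  have hex : ∃ k : ℕ, ∃ B, REq A B ∧ 0 < B 0 0 ∧ (B 0 0).toNat = k := by
    obtain ⟨B, hB, h⟩ := exists_pos A hA
    exact ⟨_, B, hB, h, rfl⟩
  obtain ⟨B, hB, hpos, hk⟩ := Nat.find_spec hex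
  have hmin : ∀ C, REq A C → 0 < C 0 0 → B 0 0 ≤ C 0 0 := by
    intro C hC h
    have := Nat.find_min' hex ⟨C, hC, h, rfl⟩
    omega
  have hdvd : ∀ j : Fin (n + 1), B 0 0 ∣ B 0 j.succ := by
    intro j
    by_contra hnd
    have hne : (0 : Fin (n + 2)) ≠ j.succ := (Fin.succ_ne_zero j).symm
    obtain ⟨C, hC, h1, h2⟩ := REq.col B 0 j.succ hne (-(B 0 j.succ / B 0 0) - 1)
    obtain ⟨D, hD, h3, h4⟩ := REq.col C j.succ 0 hne.symm 1
    have e1 : D 0 0 = B 0 j.succ % B 0 0 := by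
      rw [h3, h1, h2 0 0 hne, Int.emod_def]
      ring
    have h5 := Int.emod_lt_of_pos (B 0 j.succ) hpos
    have h6 := Int.emod_nonneg (B 0 j.succ) hpos.ne'
    have h7 : B 0 j.succ % B 0 0 ≠ 0 := fun h => hnd (Int.dvd_of_emod_eq_zero h)
    have := hmin D ((hB.trans hC).trans hD) (by omega)
    omega
  choose q hq using hdvd
  refine ⟨B 0 0, fun i => B i.succ 0, Matrix.of fun i j => B i.succ j.succ - B i.succ 0 * q j, hpos,
    hB.trans ⟨blk 1 (-q) 0 1, by simp [det_blk_col], ?_⟩⟩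
  ext i j
  rw [Matrix.mul_apply, Fin.sum_univ_succ]
  induction i using Fin.cases <;> induction j using Fin.cases <;>
    simp [Matrix.one_apply, hq] <;> ring

lemma exists_cosets {n : ℕ} (B : Matrix (Fin n) (Fin n) ℤ) (hB : B.det ≠ 0) :
    ∃ T : Finset (Fin n → ℤ), T.card ≤ B.det.natAbs ∧ ∀ w, ∃ u, w + B *ᵥ u ∈ T := by
  classical
  have hinj : Function.Injective B.mulVecLin := by
    rw [← LinearMap.ker_eq_bot]
    rw [LinearMap.ker_eq_bot']
    intro m hm
    exact Matrix.eq_zero_of_mulVec_eq_zero hB (by simpa using hm)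
  let N := LinearMap.range B.mulVecLin
  let e : (Fin n → ℤ) ≃ₗ[ℤ] N := LinearEquiv.ofInjective B.mulVecLin hinj
  have hc := Submodule.natAbs_det_equiv N e
  have he : (N.subtype ∘ₗ (e : (Fin n → ℤ) →ₗ[ℤ] N)) = Matrix.toLin' B := by
    ext; rfl
  have hc' : B.det.natAbs = Nat.card ((Fin n → ℤ) ⧸ N) := by
    rw [← hc, ← LinearMap.det_toLin' B, ← he]
    rfl
  have hfin : Finite ((Fin n → ℤ) ⧸ N) := by
    apply Nat.finite_of_card_ne_zero
    rw [← hc']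
    simpa using hB
  have := Fintype.ofFinite ((Fin n → ℤ) ⧸ N)
  refine ⟨Finset.univ.image (fun x : (Fin n → ℤ) ⧸ N => Quotient.out x), ?_, ?_⟩
  · refine Finset.card_image_le.trans ?_
    rw [hc', Nat.card_eq_fintype_card, Finset.card_univ]
  · intro w
    have h : (Submodule.Quotient.mk (Quotient.out (Submodule.Quotient.mk w : (Fin n → ℤ) ⧸ N)) :
        (Fin n → ℤ) ⧸ N) = Submodule.Quotient.mk w := Quotient.out_eq _
    rw [Submodule.Quotient.eq] at h
    obtain ⟨u, hu⟩ := h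
    refine ⟨u, Finset.mem_image.mpr ⟨Submodule.Quotient.mk w, Finset.mem_univ _, ?_⟩⟩
    have hu' : B *ᵥ u = _ := hu
    rw [hu']
    abel

lemma geom_bound (q l : ℕ) (hq : 2 ≤ q) :
    ∑ k ∈ Finset.range (l + 1), q ^ k ≤ 2 * q ^ l := by
  induction l with
  | zero => simp
  | succ l ih =>
    rw [Finset.sum_range_succ]
    have : 2 * q ^ l ≤ q ^ (l + 1) := by
      rw [pow_succ, mul_comm]; exact Nat.mul_le_mul_left _ hq
    omega

lemma exists_reps (p : ℕ) (hp : p.Prime) (n : ℕ) : ∀ l : ℕ,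
    ∃ S : Finset (Matrix (Fin (n + 1)) (Fin (n + 1)) ℤ), S.card ≤ 2 ^ n * p ^ (l * n) ∧
      ∀ A : Matrix (Fin (n + 1)) (Fin (n + 1)) ℤ, A.det = (p : ℤ) ^ l →
        ∃ B ∈ S, REq A B := by
  classical
  induction n with
  | zero =>
    intro l
    refine ⟨{Matrix.of fun _ _ => (p : ℤ) ^ l}, by simp, ?_⟩
    intro A hA
    refine ⟨_, Finset.mem_singleton_self _, ?_⟩
    convert REq.refl A
    ext i j
    rw [Matrix.det_fin_one] at hA
    fin_cases i; fin_cases j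
    simpa using hA.symm
  | succ n ih =>
    intro l
    choose S hS hS' using ih
    have hp0 : (p : ℤ) ≠ 0 := by exact_mod_cast hp.ne_zero
    have hT : ∀ B : Matrix (Fin (n + 1)) (Fin (n + 1)) ℤ, ∃ T : Finset (Fin (n + 1) → ℤ),
        B.det ≠ 0 → T.card ≤ B.det.natAbs ∧ ∀ w, ∃ u, w + B *ᵥ u ∈ T := by
      intro B
      by_cases h : B.det = 0
      · exact ⟨∅, fun h' => absurd h h'⟩
      · obtain ⟨T, hT⟩ := exists_cosets B h
        exact ⟨T, fun _ => hT⟩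
    choose T hT using hT
    refine ⟨(Finset.range (l + 1)).biUnion fun k =>
      ((S k).filter fun B => B.det = (p : ℤ) ^ k).biUnion fun B =>
        (T B).image fun w => blk ((p : ℤ) ^ (l - k)) 0 w B, ?_, ?_⟩
    · have h1 : ∀ k, (((S k).filter fun B => B.det = (p : ℤ) ^ k).biUnion fun B =>
          (T B).image fun w => blk ((p : ℤ) ^ (l - k)) 0 w B).card ≤
          2 ^ n * (p ^ (n + 1)) ^ k := by
        intro k
        refine (Finset.card_biUnion_le_card_mul _ _ (p ^ k) ?_).trans ?_
        · intro B hB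
          rw [Finset.mem_filter] at hB
          refine Finset.card_image_le.trans ?_
          have := (hT B (by rw [hB.2]; positivity)).1
          rwa [hB.2, Int.natAbs_pow, Int.natAbs_natCast] at this
        · calc _ ≤ (2 ^ n * p ^ (k * n)) * p ^ k :=
                Nat.mul_le_mul_right _ ((Finset.card_filter_le _ _).trans (hS k))
            _ = _ := by rw [mul_assoc, ← pow_add, ← pow_mul]; congr 2; ring
      refine Finset.card_biUnion_le.trans ((Finset.sum_le_sum fun k _ => h1 k).trans ?_)
      rw [← Finset.mul_sum]
      have hq : 2 ≤ p ^ (n + 1) := hp.two_le.trans (Nat.le_self_pow (by simp) p)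
      calc _ ≤ 2 ^ n * (2 * (p ^ (n + 1)) ^ l) := Nat.mul_le_mul_left _ (geom_bound _ l hq)
        _ = _ := by rw [← pow_mul, mul_comm (n + 1) l]; ring
    · intro A hA
      obtain ⟨d, w, B, hd, hAB⟩ := exists_row A (by rw [hA]; positivity)
      have hdet := hAB.det
      rw [det_blk_row, hA] at hdet
      obtain ⟨e, he, hde⟩ := (Nat.dvd_prime_pow hp (m := l) (i := d.natAbs)).mp (by
        have : d ∣ (p : ℤ) ^ l := ⟨_, hdet.symm⟩
        have := Int.natAbs_dvd_natAbs.mpr this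
        rwa [Int.natAbs_pow, Int.natAbs_natCast] at this)
      have hde' : d = (p : ℤ) ^ e := by
        have : (d.natAbs : ℤ) = d := Int.natAbs_of_nonneg hd.le
        rw [← this, hde]; simp
      have hBdet : B.det = (p : ℤ) ^ (l - e) := by
        rw [hde', ← Nat.add_sub_of_le he, pow_add] at hdet
        have := mul_left_cancel₀ (pow_ne_zero _ hp0) hdet
        simpa using this
      obtain ⟨B', hB', s, hs, hBs⟩ := hS' (l - e) B hBdet
      have hB'det : B'.det = (p : ℤ) ^ (l - e) := by rw [hBs]; simp [hs, hBdet]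
      obtain ⟨u, hu⟩ := (hT B' (by rw [hB'det]; positivity)).2 w
      refine ⟨blk d 0 (w + B' *ᵥ u) B', ?_, ?_⟩
      · refine Finset.mem_biUnion.mpr ⟨l - e, Finset.mem_range.mpr (by omega),
          Finset.mem_biUnion.mpr ⟨B', Finset.mem_filter.mpr ⟨hB', hB'det⟩,
          Finset.mem_image.mpr ⟨_, hu, ?_⟩⟩⟩
        rw [hde', Nat.sub_sub_self he]
      · refine hAB.trans ⟨blk 1 0 (s *ᵥ u) s, by simp [det_blk_row, hs], ?_⟩
        rw [blk_mul, Matrix.mulVec_mulVec, ← hBs]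

lemma orbRel_equiv (p n l : ℕ) : Equivalence (orbRel p n l) where
  refl A := ⟨1, by simp⟩
  symm := by
    rintro A B ⟨s, hs⟩
    refine ⟨s⁻¹, ?_⟩
    rw [hs, Matrix.mul_assoc, ← Matrix.SpecialLinearGroup.coe_mul]
    simp
  trans := by
    rintro A B C ⟨s, hs⟩ ⟨t, ht⟩
    refine ⟨s * t, ?_⟩
    rw [ht, hs, Matrix.mul_assoc, ← Matrix.SpecialLinearGroup.coe_mul]

lemma upper (p : ℕ) (hp : p.Prime) (n l : ℕ) :
    Finite (Quot (orbRel p (n + 1) l)) ∧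
      Nat.card (Quot (orbRel p (n + 1) l)) ≤ 2 ^ n * p ^ (l * n) := by
  classical
  obtain ⟨S, hS, hS'⟩ := exists_reps p hp n l
  have hrep : ∀ x : Quot (orbRel p (n + 1) l), ∃ B : S, ∃ h : B.1 ∈ Rset p (n + 1) l,
      x = Quot.mk _ ⟨B.1, h⟩ := by
    intro x
    induction x using Quot.ind with
    | mk A =>
      obtain ⟨B, hB, h⟩ := hS' A.1 A.2
      refine ⟨⟨B, hB⟩, h.det.trans A.2, Quot.sound ?_⟩
      obtain ⟨s, hs, h⟩ := h
      exact ⟨⟨s, hs⟩, h⟩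
  choose f hf hf' using hrep
  have hinj : Function.Injective f := by
    intro x y h
    rw [hf' x, hf' y]
    congr 2
    rw [h]
  refine ⟨Finite.of_injective f hinj, ?_⟩
  have := Nat.card_le_card_of_injective f hinj
  rw [Nat.card_eq_fintype_card (α := S), Fintype.card_coe] at this
  exact this.trans hS

lemma lower (p : ℕ) (hp : p.Prime) (n l : ℕ) [Finite (Quot (orbRel p (n + 1) l))] :
    p ^ (l * n) ≤ Nat.card (Quot (orbRel p (n + 1) l)) := by
  let f : (Fin n → Fin (p ^ l)) → Quot (orbRel p (n + 1) l) := fun v =>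
    Quot.mk _ ⟨blk ((p : ℤ) ^ l) (fun i => ((v i : ℕ) : ℤ)) 0 1, by
      simp [Rset, det_blk_col]⟩
  have hinj : Function.Injective f := by
    intro v v' h
    have h1 := (orbRel_equiv p (n + 1) l).eqvGen_iff.mp (Quot.eqvGen_exact h)
    obtain ⟨s, hs⟩ := h1
    simp only at hs
    have hss : ∀ i j : Fin n, s.1 i.succ j.succ = (1 : Matrix (Fin n) (Fin n) ℤ) i j := by
      intro i j
      have := congrFun (congrFun hs i.succ) j.succ
      rw [Matrix.mul_apply, Fin.sum_univ_succ] at this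
      simp [Matrix.one_apply] at this
      simp [Matrix.one_apply, this]
    ext j
    have := congrFun (congrFun hs 0) j.succ
    rw [Matrix.mul_apply, Fin.sum_univ_succ] at this
    simp only [blk_zs, blk_zz, hss, Matrix.one_apply] at this
    simp at this
    have hmod : ((v' j : ℕ) : ℤ) % ((p ^ l : ℕ) : ℤ) = ((v j : ℕ) : ℤ) % ((p ^ l : ℕ) : ℤ) := by
      rw [this]; push_cast; simp
    rw [← Int.natCast_mod, ← Int.natCast_mod, Nat.mod_eq_of_lt (v' j).2,
      Nat.mod_eq_of_lt (v j).2] at hmod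
    exact_mod_cast hmod.symm
  have := Nat.card_le_card_of_injective f hinj
  simpa [pow_mul] using this

/-- There are constants `c, C > 0` (depending only on `n` and `p`) such that for every
`l` the set of orbits of the right-multiplication action of `SL_n(ℤ)` on `R(p^l)` is
finite of cardinality `≍ p ^ (l (n - 1))`. -/
theorem stmt7 (p : ℕ) (hp : p.Prime) (n : ℕ) (hn : 2 ≤ n) :
    ∃ c C : ℝ, 0 < c ∧ 0 < C ∧ ∀ l : ℕ,
      Finite (Quot (orbRel p n l)) ∧
      c * (p : ℝ) ^ (l * (n - 1)) ≤ (Nat.card (Quot (orbRel p n l)) : ℝ) ∧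
      (Nat.card (Quot (orbRel p n l)) : ℝ) ≤ C * (p : ℝ) ^ (l * (n - 1)) := by
  obtain ⟨m, rfl⟩ : ∃ m, n = m + 1 := ⟨n - 1, by omega⟩
  refine ⟨1, 2 ^ m, one_pos, by positivity, fun l => ?_⟩
  obtain ⟨hfin, hup⟩ := upper p hp m l
  have hlo := lower p hp m l
  rw [Nat.add_sub_cancel]
  exact ⟨hfin, by rw [one_mul]; exact_mod_cast hlo, by exact_mod_cast hup⟩
end
end
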